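/- For every x ∈ Y_p(gl_2) and every generator z ∈ {t_{22}^{(1)},...,t_{22}^{(p)}, d_1,...,d_{2p}} of Γ, the Γ-bimodule Γ x Γ is finitely generated both as a left Γ-module and as a right Γ-module; i.e., Γ is a Harish-Chandra subalgebra of Y_p(gl_2). In particular, for x = t_{21}^{(k)} and z = t_{22}^{(i)} there is a monic relation (t_{22}^{(i)})^p t_{21}^{(k)} + Σ_{l=0}^{p-1} (t_{22}^{(i)})^l t_{21}^{(k)} a_l = 0 with a_l ∈ Γ. -/

import Mathlib

open Polynomial

/-- Generator index for the level-`p` Yangian: `(i, j, k)` with `k : Fin p` encoding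
the superscript `k+1`. -/
abbrev YGen (p : ℕ) := Fin 2 × Fin 2 × Fin p

/-- The free-algebra version of the generator `t_{ij}^{(r)}`, with the conventions
`t_{ij}^{(0)} = δ_{ij}` and `t_{ij}^{(r)} = 0` for `r > p`. -/
noncomputable def tF (K : Type) [Field K] (p : ℕ) (i j : Fin 2) (r : ℕ) :
    FreeAlgebra K (YGen p) :=
  if h0 : r = 0 then (if i = j then 1 else 0)
  else if h : r ≤ p then FreeAlgebra.ι K (i, j, (⟨r - 1, by omega⟩ : Fin p)) else 0

/-- The defining relations of the level-`p` Yangian: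
`[t_{ij}^{(r)}, t_{kl}^{(s)}] = Σ_{a=1}^{min(r,s)} (t_{kj}^{(a-1)} t_{il}^{(r+s-a)} -
t_{kj}^{(r+s-a)} t_{il}^{(a-1)})`. -/
inductive YRel (K : Type) [Field K] (p : ℕ) :
    FreeAlgebra K (YGen p) → FreeAlgebra K (YGen p) → Prop
  | rel (i j k l : Fin 2) (r s : ℕ) (hr : 1 ≤ r) (hr' : r ≤ p) (hs : 1 ≤ s) (hs' : s ≤ p) :
      YRel K p (tF K p i j r * tF K p k l s - tF K p k l s * tF K p i j r)
        (∑ a ∈ Finset.Icc 1 (min r s),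
          (tF K p k j (a - 1) * tF K p i l (r + s - a)
            - tF K p k j (r + s - a) * tF K p i l (a - 1)))

/-- The level-`p` Yangian `Y_p(gl_2)`. -/
abbrev Yp (K : Type) [Field K] (p : ℕ) := RingQuot (YRel K p)

/-- The generator `t_{ij}^{(r)}` of `Y_p(gl_2)` (matrix indices `0,1` stand for `1,2`). -/
noncomputable def tY (K : Type) [Field K] (p : ℕ) (i j : Fin 2) (r : ℕ) : Yp K p :=
  RingQuot.mkAlgHom K (YRel K p) (tF K p i j r)

/-- The generating polynomial `T_{ij}(u) = δ_{ij} u^p + Σ_{k=1}^p t_{ij}^{(k)} u^{p-k}`. -/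
noncomputable def TY (K : Type) [Field K] (p : ℕ) (i j : Fin 2) : Polynomial (Yp K p) :=
  (if i = j then X ^ p else 0) + ∑ k ∈ Finset.Icc 1 p, C (tY K p i j k) * X ^ (p - k)

/-- The quantum determinant `D(u) = T_{11}(u) T_{22}(u-1) - T_{21}(u) T_{12}(u-1)`. -/
noncomputable def DY (K : Type) [Field K] (p : ℕ) : Polynomial (Yp K p) :=
  TY K p 0 0 * (TY K p 1 1).comp (X - 1) - TY K p 1 0 * (TY K p 0 1).comp (X - 1)

/-- The coefficient `d_i` of the quantum determinant: `D(u) = u^{2p} + Σ_i d_i u^{2p-i}`. -/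
noncomputable def dY (K : Type) [Field K] (p : ℕ) (i : ℕ) : Yp K p :=
  (DY K p).coeff (2 * p - i)

/-- The commutative subalgebra `Γ` generated by `t_{22}^{(1)},…,t_{22}^{(p)}` and
`d_1,…,d_{2p}`. -/
noncomputable def Gam (K : Type) [Field K] (p : ℕ) : Subalgebra K (Yp K p) :=
  Algebra.adjoin K
    ({x | ∃ k ∈ Finset.Icc 1 p, x = tY K p 1 1 k} ∪
     {x | ∃ i ∈ Finset.Icc 1 (2 * p), x = dY K p i})

/-- The `Γ`-bimodule `Γ x Γ`: the `k`-span of the products `a·x·b` with `a, b ∈ Γ`. -/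
noncomputable def GamxGam (K : Type) [Field K] (p : ℕ) (x : Yp K p) :
    Submodule K (Yp K p) :=
  Submodule.span K {y | ∃ a ∈ Gam K p, ∃ b ∈ Gam K p, y = a * x * b}

section Relations

variable {K : Type} [Field K] {p : ℕ}

theorem tY_zero (i j : Fin 2) : tY K p i j 0 = if i = j then 1 else 0 := by
  unfold tY tF
  rw [dif_pos rfl]
  split_ifs <;> simp

theorem tY_of_lt (i j : Fin 2) {r : ℕ} (h : p < r) : tY K p i j r = 0 := by
  unfold tY tF
  rw [dif_neg (by omega), dif_neg (by omega), map_zero]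

/-- The defining relations hold for all superscripts, not only those in `[1, p]`. -/
theorem tY_rel (i j k l : Fin 2) (r s : ℕ) :
    tY K p i j r * tY K p k l s - tY K p k l s * tY K p i j r =
      ∑ a ∈ Finset.Icc 1 (min r s),
        (tY K p k j (a - 1) * tY K p i l (r + s - a)
          - tY K p k j (r + s - a) * tY K p i l (a - 1)) := by
  rcases Nat.eq_zero_or_pos r with rfl | hr
  · rw [tY_zero]
    split_ifs <;> simp
  rcases Nat.eq_zero_or_pos s with rfl | hs
  · rw [tY_zero]
    split_ifs <;> simp
  by_cases h : r ≤ p ∧ s ≤ p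
  · have := RingQuot.mkAlgHom_rel K (YRel.rel (K := K) i j k l r s hr h.1 hs h.2)
    simpa [tY, map_sub, map_mul, map_sum] using this
  · have hp : p < r ∨ p < s := by omega
    rw [Finset.sum_eq_zero]
    · rcases hp with hp | hp <;> simp [tY_of_lt _ _ hp]
    · intro a ha
      rw [Finset.mem_Icc] at ha
      rw [tY_of_lt i l (by omega : p < r + s - a), tY_of_lt k j (by omega : p < r + s - a)]
      simp

end Relations

/-- A family satisfying the defining relations of the generators `t_ij^(r)` of `Y_p(gl_2)`. -/
structure IsYangianFamily {A : Type*} [Ring A] (p : ℕ) (t : Fin 2 → Fin 2 → ℕ → A) : Prop where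
  zero (i j : Fin 2) : t i j 0 = if i = j then 1 else 0
  of_lt (i j : Fin 2) {r : ℕ} (h : p < r) : t i j r = 0
  rel (i j k l : Fin 2) (r s : ℕ) :
    t i j r * t k l s - t k l s * t i j r =
      ∑ a ∈ Finset.Icc 1 (min r s),
        (t k j (a - 1) * t i l (r + s - a) - t k j (r + s - a) * t i l (a - 1))

section Family

variable {A : Type*} [Ring A] {p : ℕ} {t : Fin 2 → Fin 2 → ℕ → A}

theorem IsYangianFamily.rel_succ (h : IsYangianFamily p t) (i j k l : Fin 2) (r s : ℕ) :
    (t i j (r + 1) * t k l s - t k l s * t i j (r + 1)) -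
      (t i j r * t k l (s + 1) - t k l (s + 1) * t i j r) =
      t k j r * t i l s - t k j s * t i l r := by
  rw [h.rel, h.rel, show r + (s + 1) = r + 1 + s by omega]
  rcases lt_trichotomy r s with hrs | rfl | hrs
  · rw [show min (r + 1) s = r + 1 by omega, show min r (s + 1) = r by omega,
      Finset.sum_Icc_succ_top (by omega), add_sub_cancel_left]
    simp [show r + 1 + s - (r + 1) = s by omega]
  · rw [show min (r + 1) r = r by omega, show min r (r + 1) = r by omega]
    simp
  · rw [show min (r + 1) s = s by omega, show min r (s + 1) = s + 1 by omega,
      Finset.sum_Icc_succ_top (by omega), sub_add_cancel_left]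
    simp [show r + 1 + s - (s + 1) = r by omega]

theorem IsYangianFamily.comm (h : IsYangianFamily p t) (i j : Fin 2) (r s : ℕ) :
    t i j r * t i j s = t i j s * t i j r := by
  suffices H : ∀ m r s, min r s ≤ m → t i j r * t i j s = t i j s * t i j r
    from H _ r s le_rfl
  intro m
  induction m with
  | zero =>
    intro r s hm
    rw [← sub_eq_zero, h.rel, Nat.le_zero.mp hm]
    simp
  | succ m ih =>
    intro r s hm
    rw [← sub_eq_zero, h.rel]
    refine Finset.sum_eq_zero fun a ha => ?_
    rw [Finset.mem_Icc] at ha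
    rw [ih _ _ (by omega), sub_self]

end Family

theorem tY_isYangianFamily (K : Type) [Field K] (p : ℕ) : IsYangianFamily p (tY K p) :=
  ⟨tY_zero, tY_of_lt, tY_rel⟩

/-- The form `T_nn(a-1) T_mm(a) - T_nm(a-1) T_mn(a)` of the quantum determinant commutes with
`T_nn(b)`, up to the factor `a - b`. -/
theorem qdet_commute_diag {R Z : Type*} [CommRing R] [Ring Z] [Algebra R Z]
    (T : Fin 2 → Fin 2 → R → Z)
    (rel : ∀ i j k l x y, (x - y) • (T i j x * T k l y - T k l y * T i j x) =
      T k j x * T i l y - T k j y * T i l x)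
    (hcomm : ∀ i j x y, T i j x * T i j y = T i j y * T i j x) (m n : Fin 2) (a b : R) :
    (a - b) • (T n n b * (T n n (a - 1) * T m m a - T n m (a - 1) * T m n a)
      - (T n n (a - 1) * T m m a - T n m (a - 1) * T m n a) * T n n b) = 0 := by
  have h0 := congrArg (· * T m m a) (hcomm n n b (a - 1))
  have h1 := congrArg (· * T m n a) (rel n n n m b (a - 1))
  have h2 := congrArg (T n n (a - 1) * ·) (rel m m n n a b)
  have h3 := congrArg (T n m (a - 1) * ·) (rel m n n n a b)
  have h4 := congrArg (· * T m n b) (rel n n n m a (a - 1))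
  simp only [mul_sub, sub_mul, smul_mul_assoc, mul_smul_comm, mul_assoc, smul_sub]
    at h0 h1 h2 h3 h4 ⊢
  linear_combination (norm := module) (a - b) • h0 + h1 - h2 + h3 - h4

/-- The form `T_nn(a-1) T_mm(a) - T_nm(a-1) T_mn(a)` of the quantum determinant commutes with
`T_nm(b)`, up to the factor `a - b`. -/
theorem qdet_commute_offdiag {R Z : Type*} [CommRing R] [Ring Z] [Algebra R Z]
    (T : Fin 2 → Fin 2 → R → Z)
    (rel : ∀ i j k l x y, (x - y) • (T i j x * T k l y - T k l y * T i j x) =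
      T k j x * T i l y - T k j y * T i l x)
    (hcomm : ∀ i j x y, T i j x * T i j y = T i j y * T i j x) (m n : Fin 2) (a b : R) :
    (a - b) • (T n m b * (T n n (a - 1) * T m m a - T n m (a - 1) * T m n a)
      - (T n n (a - 1) * T m m a - T n m (a - 1) * T m n a) * T n m b) = 0 := by
  have h0 := congrArg (· * T m n a) (hcomm n m b (a - 1))
  have h1 := congrArg (· * T m m a) (rel n m n n b (a - 1))
  have h2 := congrArg (T n n (a - 1) * ·) (rel m m n m a b)
  have h3 := congrArg (T n m (a - 1) * ·) (rel m n n m a b)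
  have h4 := congrArg (· * T m m b) (rel n n n m a (a - 1))
  simp only [mul_sub, sub_mul, smul_mul_assoc, mul_smul_comm, mul_assoc, smul_sub]
    at h0 h1 h2 h3 h4 ⊢
  linear_combination (norm := module) -(a - b) • h0 - h1 - h2 + h3 - h4

theorem qdet_eq_left {R Z : Type*} [CommRing R] [Ring Z] [Algebra R Z]
    (T : Fin 2 → Fin 2 → R → Z)
    (rel : ∀ i j k l x y, (x - y) • (T i j x * T k l y - T k l y * T i j x) =
      T k j x * T i l y - T k j y * T i l x) (m n : Fin 2) (a : R) :
    T m m a * T n n (a - 1) - T n m a * T m n (a - 1) =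
      T n n (a - 1) * T m m a - T n m (a - 1) * T m n a := by
  have h := rel m m n n a (a - 1)
  rw [sub_sub_cancel, one_smul] at h
  linear_combination (norm := module) h

theorem qdet_eq_right {R Z : Type*} [CommRing R] [Ring Z] [Algebra R Z]
    (T : Fin 2 → Fin 2 → R → Z)
    (rel : ∀ i j k l x y, (x - y) • (T i j x * T k l y - T k l y * T i j x) =
      T k j x * T i l y - T k j y * T i l x) (m n : Fin 2) (a : R) :
    T m m a * T n n (a - 1) - T n m a * T m n (a - 1) =
      T m m (a - 1) * T n n a - T m n (a - 1) * T n m a := by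
  have h := rel n m m n a (a - 1)
  rw [sub_sub_cancel, one_smul] at h
  linear_combination (norm := module) -h

section Evaluation

variable {A R Z : Type*} [Ring A] [CommRing R] [Ring Z] [Algebra R Z] {p : ℕ}
  {t : Fin 2 → Fin 2 → ℕ → A}

/-- The value at the scalar `x` of the generating polynomial `T_ij`, in an algebra receiving a
ring homomorphism from the Yangian. -/
noncomputable def TEval (p : ℕ) (t : Fin 2 → Fin 2 → ℕ → A) (f : A →+* Z) (i j : Fin 2) (x : R) :
    Z :=
  ∑ k ∈ Finset.range (p + 1), x ^ (p - k) • f (t i j k)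

theorem TEval_mul_TEval (f : A →+* Z) (i j k l : Fin 2) (x y : R) :
    TEval p t f i j x * TEval p t f k l y = ∑ r ∈ Finset.range (p + 1), x ^ (p - r) •
      ∑ s ∈ Finset.range (p + 1), y ^ (p - s) • f (t i j r * t k l s) := by
  simp only [TEval, Finset.sum_mul_sum, smul_mul_assoc, mul_smul_comm, map_mul, Finset.smul_sum]
  exact Finset.sum_congr rfl fun r _ => Finset.sum_congr rfl fun s _ => smul_comm _ _ _

theorem TEval_mul_TEval_swap (f : A →+* Z) (i j k l : Fin 2) (x y : R) :
    TEval p t f i j y * TEval p t f k l x = ∑ r ∈ Finset.range (p + 1), x ^ (p - r) •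
      ∑ s ∈ Finset.range (p + 1), y ^ (p - s) • f (t i j s * t k l r) := by
  rw [TEval_mul_TEval]
  simp only [Finset.smul_sum]
  rw [Finset.sum_comm]
  refine Finset.sum_congr rfl fun r _ => Finset.sum_congr rfl fun s _ => ?_
  rw [smul_comm]

theorem sum_pow_smul_shift {M : Type*} [AddCommGroup M] [Module R M] (p : ℕ) (x : R) (c : ℕ → M)
    (h0 : c 0 = 0) (hp : c (p + 1) = 0) :
    ∑ r ∈ Finset.range (p + 1), x ^ (p - r) • c (r + 1) =
      x • ∑ r ∈ Finset.range (p + 1), x ^ (p - r) • c r := by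
  rw [Finset.sum_range_succ, hp, smul_zero, add_zero, Finset.sum_range_succ', h0, smul_zero,
    add_zero, Finset.smul_sum]
  refine Finset.sum_congr rfl fun r hr => ?_
  rw [Finset.mem_range] at hr
  rw [smul_smul, ← pow_succ', show p - (r + 1) + 1 = p - r by omega]

theorem IsYangianFamily.TEval_rel (h : IsYangianFamily p t) (f : A →+* Z) (i j k l : Fin 2)
    (x y : R) :
    (x - y) • (TEval p t f i j x * TEval p t f k l y - TEval p t f k l y * TEval p t f i j x) =
      TEval p t f k j x * TEval p t f i l y - TEval p t f k j y * TEval p t f i l x := by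
  set c : ℕ → ℕ → Z := fun r s => f (t i j r * t k l s - t k l s * t i j r) with hc
  have c0 (s) : c 0 s = 0 := by
    simp only [hc, h.zero]; split_ifs <;> simp
  have c0' (r) : c r 0 = 0 := by
    simp only [hc, h.zero]; split_ifs <;> simp
  have cp (s) : c (p + 1) s = 0 := by simp [hc, h.of_lt i j (Nat.lt_succ_self p)]
  have cp' (r) : c r (p + 1) = 0 := by simp [hc, h.of_lt k l (Nat.lt_succ_self p)]
  have hL : TEval p t f i j x * TEval p t f k l y - TEval p t f k l y * TEval p t f i j x =
      ∑ r ∈ Finset.range (p + 1), x ^ (p - r) •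
        ∑ s ∈ Finset.range (p + 1), y ^ (p - s) • c r s := by
    rw [TEval_mul_TEval, TEval_mul_TEval_swap, ← Finset.sum_sub_distrib]
    refine Finset.sum_congr rfl fun r _ => ?_
    rw [← smul_sub, ← Finset.sum_sub_distrib]
    simp only [← smul_sub, hc, map_sub]
  have hR : TEval p t f k j x * TEval p t f i l y - TEval p t f k j y * TEval p t f i l x =
      ∑ r ∈ Finset.range (p + 1), x ^ (p - r) •
        ∑ s ∈ Finset.range (p + 1), y ^ (p - s) • (c (r + 1) s - c r (s + 1)) := by
    rw [TEval_mul_TEval, TEval_mul_TEval_swap, ← Finset.sum_sub_distrib]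
    refine Finset.sum_congr rfl fun r _ => ?_
    rw [← smul_sub, ← Finset.sum_sub_distrib]
    refine congrArg _ (Finset.sum_congr rfl fun s _ => ?_)
    rw [← smul_sub, ← map_sub, ← h.rel_succ]
    simp only [hc, map_sub]
  have hx := sum_pow_smul_shift p x
    (fun r => ∑ s ∈ Finset.range (p + 1), y ^ (p - s) • c r s) (by simp [c0]) (by simp [cp])
  have hy (r) := sum_pow_smul_shift p y (c r) (c0' r) (cp' r)
  rw [hL, hR]
  simp only [smul_sub, Finset.sum_sub_distrib]
  simp only [hy, hx, sub_smul]
  congr 1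
  rw [Finset.smul_sum]
  exact Finset.sum_congr rfl fun r _ => smul_comm _ _ _

theorem IsYangianFamily.TEval_comm (h : IsYangianFamily p t) (f : A →+* Z) (i j : Fin 2)
    (x y : R) :
    TEval p t f i j x * TEval p t f i j y = TEval p t f i j y * TEval p t f i j x := by
  rw [TEval_mul_TEval, TEval_mul_TEval_swap]
  simp only [h.comm i j]

end Evaluation

section QuantumDeterminant

variable {A : Type*} [Ring A] {p : ℕ} {t : Fin 2 → Fin 2 → ℕ → A}

/-- The generating polynomial `T_ij(u)` of a family of elements. -/
noncomputable def genPoly (p : ℕ) (t : Fin 2 → Fin 2 → ℕ → A) (i j : Fin 2) : A[X] :=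
  (if i = j then X ^ p else 0) + ∑ k ∈ Finset.Icc 1 p, C (t i j k) * X ^ (p - k)

/-- The quantum determinant of a family of elements. -/
noncomputable def qdetPoly (p : ℕ) (t : Fin 2 → Fin 2 → ℕ → A) : A[X] :=
  genPoly p t 0 0 * (genPoly p t 1 1).comp (X - 1) -
    genPoly p t 1 0 * (genPoly p t 0 1).comp (X - 1)

theorem IsYangianFamily.genPoly_eq_sum (h : IsYangianFamily p t) (i j : Fin 2) :
    genPoly p t i j = ∑ k ∈ Finset.range (p + 1), C (t i j k) * X ^ (p - k) := by
  rw [Finset.range_eq_Ico, Finset.sum_eq_sum_Ico_succ_bot (by omega), h.zero, genPoly]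
  congr 1
  split_ifs <;> simp

/-- The element `u` of the centre of `A[u][v]`. -/
noncomputable def centralU (A : Type*) [Ring A] : Subring.center A[X][X] :=
  ⟨C X, Subring.mem_center_iff.mpr fun g => by
    ext n : 1
    rw [coeff_mul_C, coeff_C_mul, X_mul]⟩

/-- The element `v` of the centre of `A[u][v]`. -/
noncomputable def centralV (A : Type*) [Ring A] : Subring.center A[X][X] :=
  ⟨X, Subring.mem_center_iff.mpr fun _ => X_mul.symm⟩

/-- The inclusion of constants `A → A[u][v]`. -/
noncomputable abbrev constHom (A : Type*) [Ring A] : A →+* A[X][X] :=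
  (C : A[X] →+* A[X][X]).comp C

theorem IsYangianFamily.TEval_centralU (h : IsYangianFamily p t) (i j : Fin 2) :
    TEval p t (constHom A) i j (centralU A) = C (genPoly p t i j) := by
  rw [h.genPoly_eq_sum, TEval, map_sum]
  refine Finset.sum_congr rfl fun k _ => ?_
  simp [Subring.smul_def, centralU]
  rw [← map_pow, ← C_mul, ← C_mul, X_pow_mul]

theorem IsYangianFamily.TEval_centralU_sub_one (h : IsYangianFamily p t) (i j : Fin 2) :
    TEval p t (constHom A) i j (centralU A - 1) = C ((genPoly p t i j).comp (X - 1)) := by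
  rw [h.genPoly_eq_sum, TEval, Polynomial.sum_comp, map_sum]
  refine Finset.sum_congr rfl fun k _ => ?_
  have hc : Commute (C (t i j k)) ((X : A[X]) - 1) :=
    (commute_X _).symm.sub_right (Commute.one_right _)
  rw [C_mul_comp, X_pow_comp, (hc.pow_right _).eq]
  simp [Subring.smul_def, centralU]

theorem eq_zero_of_sub_smul_eq_zero (F : A[X][X])
    (h : (centralU A - centralV A) • F = 0) : F = 0 := by
  nontriviality A
  have h' : (X - C X : A[X][X]) * F = 0 := by
    have : (X - C X : A[X][X]) * F = -((centralU A - centralV A) • F) := by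
      simp [Subring.smul_def, centralU, centralV, sub_mul]
    rw [this, h, neg_zero]
  exact (monic_X_sub_C (X : A[X])).mul_right_eq_zero_iff.mp h'

theorem IsYangianFamily.commute_coeff (h : IsYangianFamily p t) (i j : Fin 2) (D : A[X])
    (hD : (centralU A - centralV A) •
      (TEval p t (constHom A) i j (centralV A) * C D -
        C D * TEval p t (constHom A) i j (centralV A)) = 0)
    (k n : ℕ) : t i j k * D.coeff n = D.coeff n * t i j k := by
  rcases lt_or_ge p k with hk | hk
  · simp [h.of_lt i j hk]
  have h0 : TEval p t (constHom A) i j (centralV A) * C D -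
        C D * TEval p t (constHom A) i j (centralV A) =
      ∑ r ∈ Finset.range (p + 1), C (C (t i j r) * D - D * C (t i j r)) * X ^ (p - r) := by
    rw [TEval, Finset.sum_mul, Finset.mul_sum, ← Finset.sum_sub_distrib]
    refine Finset.sum_congr rfl fun r _ => ?_
    rw [smul_mul_assoc, mul_smul_comm, ← smul_sub, ← X_pow_mul]
    simp [Subring.smul_def, centralV]
  have h1 := congrArg (fun F => (F.coeff (p - k)).coeff n) (eq_zero_of_sub_smul_eq_zero _ hD)
  simp only [h0, finsetSum_coeff, coeff_C_mul_X_pow, coeff_zero] at h1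
  rw [Finset.sum_eq_single k] at h1
  · simpa [sub_eq_zero] using h1
  · intro r hr hrk
    rw [Finset.mem_range] at hr
    rw [if_neg (by omega), coeff_zero]
  · intro hk'
    exact absurd (Finset.mem_range.mpr (by omega)) hk'

theorem IsYangianFamily.commute_qdetPoly (h : IsYangianFamily p t) (i j : Fin 2)
    (k n : ℕ) :
    t i j k * (qdetPoly p t).coeff n = (qdetPoly p t).coeff n * t i j k := by
  have hD : C (qdetPoly p t) =
      TEval p t (constHom A) 0 0 (centralU A) * TEval p t (constHom A) 1 1 (centralU A - 1) -
      TEval p t (constHom A) 1 0 (centralU A) * TEval p t (constHom A) 0 1 (centralU A - 1) := by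
    simp only [h.TEval_centralU, h.TEval_centralU_sub_one, qdetPoly, map_sub, map_mul]
  have hrel := h.TEval_rel (R := Subring.center A[X][X]) (constHom A)
  have hcomm := h.TEval_comm (R := Subring.center A[X][X]) (constHom A)
  have hl := hD.trans (qdet_eq_left _ hrel 0 1 (centralU A))
  have hr := hD.trans (qdet_eq_right _ hrel 0 1 (centralU A))
  apply h.commute_coeff
  fin_cases i <;> fin_cases j
  · rw [hr]
    exact qdet_commute_diag _ hrel hcomm 1 0 _ _
  · rw [hr]
    exact qdet_commute_offdiag _ hrel hcomm 1 0 _ _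
  · rw [hl]
    exact qdet_commute_offdiag _ hrel hcomm 0 1 _ _
  · rw [hl]
    exact qdet_commute_diag _ hrel hcomm 0 1 _ _

end QuantumDeterminant

section HarishChandra

variable {K A : Type*} [Field K] [Ring A] [Algebra K A]

theorem adjoin_mul_le_mul_adjoin {s : Set A} {V : Submodule K A}
    (h : ∀ g ∈ s, ∀ v ∈ V, g * v ∈ V * (Algebra.adjoin K s).toSubmodule) :
    (Algebra.adjoin K s).toSubmodule * V ≤ V * (Algebra.adjoin K s).toSubmodule := by
  refine Submodule.mul_le.mpr fun x hx => ?_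
  refine Algebra.adjoin_induction (p := fun x _ => ∀ v ∈ V, x * v ∈ _) h ?_ ?_ ?_ hx
  · intro r v hv
    rw [Algebra.commutes]
    exact Submodule.mul_mem_mul hv (Subalgebra.algebraMap_mem _ r)
  · intro x y _ _ hx hy v hv
    rw [add_mul]
    exact add_mem (hx v hv) (hy v hv)
  · intro x y _ hy' hx hy v hv
    rw [mul_assoc]
    refine Submodule.mul_induction_on (hy v hv) ?_ ?_
    · intro w hw q hq
      rw [← mul_assoc]
      have := Submodule.mul_mem_mul (hx w hw) hq
      rwa [mul_assoc, (Subalgebra.isIdempotentElem_toSubmodule _).eq] at this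
    · intro a b ha hb
      rw [mul_add]
      exact add_mem ha hb

theorem mul_adjoin_le_adjoin_mul {s : Set A} {V : Submodule K A}
    (h : ∀ g ∈ s, ∀ v ∈ V, v * g ∈ (Algebra.adjoin K s).toSubmodule * V) :
    V * (Algebra.adjoin K s).toSubmodule ≤ (Algebra.adjoin K s).toSubmodule * V := by
  refine Submodule.mul_le.mpr fun v hv x hx => ?_
  revert v
  refine Algebra.adjoin_induction (p := fun x _ => ∀ v ∈ V, v * x ∈ _) h ?_ ?_ ?_ hx
  · intro r v hv
    rw [← Algebra.commutes]
    exact Submodule.mul_mem_mul (Subalgebra.algebraMap_mem _ r) hv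
  · intro x y _ _ hx hy v hv
    rw [mul_add]
    exact add_mem (hx v hv) (hy v hv)
  · intro x y _ hy' hx hy v hv
    rw [← mul_assoc]
    refine Submodule.mul_induction_on (hx v hv) ?_ ?_
    · intro q hq w hw
      rw [mul_assoc]
      have := Submodule.mul_mem_mul hq (hy w hw)
      rwa [← mul_assoc, (Subalgebra.isIdempotentElem_toSubmodule _).eq] at this
    · intro a b ha hb
      rw [add_mul]
      exact add_mem ha hb

/-- The elements lying in a finite-dimensional space `V` with `P V = V P`; for such elements `x`
the bimodule `P x P` sits inside a bimodule finitely generated on both sides. -/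
def balancedSubalgebra (P : Subalgebra K A) : Subalgebra K A where
  carrier := {x | ∃ V : Submodule K A, V.FG ∧ P.toSubmodule * V = V * P.toSubmodule ∧ x ∈ V}
  mul_mem' := by
    rintro x y ⟨V, hV, hPV, hx⟩ ⟨W, hW, hPW, hy⟩
    refine ⟨V * W, hV.mul hW, ?_, Submodule.mul_mem_mul hx hy⟩
    rw [← mul_assoc, hPV, mul_assoc, hPW, mul_assoc]
  add_mem' := by
    rintro x y ⟨V, hV, hPV, hx⟩ ⟨W, hW, hPW, hy⟩
    refine ⟨V ⊔ W, hV.sup hW, ?_, add_mem (Submodule.mem_sup_left hx) (Submodule.mem_sup_right hy)⟩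
    rw [Submodule.mul_sup, Submodule.sup_mul, hPV, hPW]
  algebraMap_mem' r :=
    ⟨1, Submodule.one_eq_span (R := K) (A := A) ▸ Submodule.fg_span_singleton 1,
      by rw [mul_one, one_mul], Submodule.algebraMap_mem r⟩

theorem mem_balancedSubalgebra_of_commute {P : Subalgebra K A} {x : A}
    (hx : ∀ y ∈ P, x * y = y * x) : x ∈ balancedSubalgebra P := by
  refine ⟨Submodule.span K {x}, Submodule.fg_span_singleton x, ?_,
    Submodule.mem_span_singleton_self x⟩
  apply le_antisymm
  · refine Submodule.mul_le.mpr fun q hq v hv => ?_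
    obtain ⟨c, rfl⟩ := Submodule.mem_span_singleton.mp hv
    rw [mul_smul_comm, ← hx q hq, ← smul_mul_assoc]
    exact Submodule.mul_mem_mul hv hq
  · refine Submodule.mul_le.mpr fun v hv q hq => ?_
    obtain ⟨c, rfl⟩ := Submodule.mem_span_singleton.mp hv
    rw [smul_mul_assoc, hx q hq, ← mul_smul_comm]
    exact Submodule.mul_mem_mul hq hv

theorem exists_mvPolynomial_range_eq_adjoin (s : Set A) (hs : ∀ a ∈ s, ∀ b ∈ s, a * b = b * a) :
    ∃ φ : MvPolynomial s K →ₐ[K] A, φ.range = Algebra.adjoin K s := by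
  have hcomm := Algebra.isMulCommutative_adjoin K hs
  let : CommRing (Algebra.adjoin K s) :=
    { (inferInstance : Ring (Algebra.adjoin K s)) with mul_comm := hcomm.is_comm.comm }
  let ψ : MvPolynomial s K →ₐ[K] Algebra.adjoin K s :=
    MvPolynomial.aeval fun x => ⟨x, Algebra.subset_adjoin x.2⟩
  refine ⟨(Algebra.adjoin K s).val.comp ψ, le_antisymm ?_ ?_⟩
  · rintro _ ⟨q, rfl⟩
    exact (ψ q).2
  · refine Algebra.adjoin_le fun x hx => ⟨MvPolynomial.X ⟨x, hx⟩, ?_⟩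
    have : ψ (MvPolynomial.X ⟨x, hx⟩) = ⟨x, Algebra.subset_adjoin hx⟩ :=
      MvPolynomial.aeval_X _ _
    exact congrArg Subtype.val this

theorem exists_fin_generators {R M : Type*} [CommRing R] [IsNoetherianRing R] [AddCommGroup M]
    [Module R M] {N W : Submodule R M} (hW : W.FG) (h : N ≤ W) :
    ∃ (n : ℕ) (g : Fin n → M), (∀ s, g s ∈ N) ∧
      ∀ y ∈ N, ∃ c : Fin n → R, y = ∑ s, c s • g s := by
  have := isNoetherian_of_fg_of_noetherian W hW
  obtain ⟨n, g, hg⟩ := Submodule.fg_iff_exists_fin_generating_family.mp (Submodule.FG.of_le hW h)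
  refine ⟨n, g, fun s => hg ▸ Submodule.subset_span ⟨s, rfl⟩, fun y hy => ?_⟩
  rw [← hg, Submodule.mem_span_range_iff_exists_fun] at hy
  obtain ⟨c, hc⟩ := hy
  exact ⟨c, hc.symm⟩

theorem exists_fin_generators_of_algHom {R B M : Type*} [CommRing R] [Algebra K R]
    [IsNoetherianRing R] [Ring B] [Algebra K B] [AddCommGroup M] [Module K M] [Module B M]
    [IsScalarTower K B M] (φ : R →ₐ[K] B) {N V : Submodule K M} (hV : V.FG)
    (hN : ∀ r, ∀ y ∈ N, φ r • y ∈ N)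
    (hle : N ≤ Submodule.span K {y | ∃ r, ∃ v ∈ V, y = φ r • v}) :
    ∃ (n : ℕ) (g : Fin n → M), (∀ s, g s ∈ N) ∧
      ∀ y ∈ N, ∃ c : Fin n → R, y = ∑ s, φ (c s) • g s := by
  let : Module R M := Module.compHom M φ.toRingHom
  have hK (k : K) (y : M) : k • y = (algebraMap K R k) • y := by
    change k • y = φ (algebraMap K R k) • y
    rw [AlgHom.commutes, algebraMap_smul]
  obtain ⟨F, rfl⟩ := hV
  let N' : Submodule R M := { N.toAddSubmonoid with smul_mem' := fun r y hy => hN r y hy }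
  let W : Submodule R M := Submodule.span R (F : Set M)
  have hVW : ∀ v ∈ Submodule.span K (F : Set M), v ∈ W := by
    intro v hv
    induction hv using Submodule.span_induction with
    | mem x hx => exact Submodule.subset_span hx
    | zero => exact zero_mem _
    | add x y _ _ hx hy => exact add_mem hx hy
    | smul k x _ hx => rw [hK]; exact W.smul_mem _ hx
  refine exists_fin_generators (N := N') (W := W) ⟨F, rfl⟩ fun y hy => ?_
  have hspan : ∀ y ∈ Submodule.span K {y | ∃ r, ∃ v ∈ Submodule.span K (F : Set M), y = φ r • v},
      y ∈ W := by
    intro y hy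
    induction hy using Submodule.span_induction with
    | mem x hx =>
      obtain ⟨r, v, hv, rfl⟩ := hx
      exact W.smul_mem r (hVW v hv)
    | zero => exact zero_mem _
    | add x y _ _ hx hy => exact add_mem hx hy
    | smul k x _ hx => rw [hK]; exact W.smul_mem _ hx
  exact hspan y (hle hy)

theorem exists_monic_relation {R M : Type*} [CommRing R] [Nontrivial R] [AddCommGroup M]
    [Module R M] {p : ℕ} (L : M →ₗ[R] M) (v : Fin p → M) (m : Matrix (Fin p) (Fin p) R)
    (h : ∀ k, L (v k) = ∑ l, m l k • v l) :
    ∃ a : Fin p → R, ∀ k, (L ^ p) (v k) + ∑ l : Fin p, a l • (L ^ (l : ℕ)) (v k) = 0 := by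
  let g : (Fin p → R) →ₗ[R] M := Fintype.linearCombination R v
  have hg : ∀ w, g (Matrix.toLin' m w) = L (g w) := by
    suffices H : g ∘ₗ Matrix.toLin' m = L ∘ₗ g from fun w => LinearMap.congr_fun H w
    refine (Pi.basisFun R (Fin p)).ext fun k => ?_
    simp [g, Fintype.linearCombination_apply, h, Matrix.mulVec_single]
  have hq : ∀ (q : R[X]) w, g (aeval (Matrix.toLin' m) q w) = aeval L q (g w) := by
    intro q
    induction q using Polynomial.induction_on' with
    | add q r hq hr => intro w; simp [hq, hr]
    | monomial n c =>
      intro w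
      have : ∀ w, g ((Matrix.toLin' m ^ n) w) = (L ^ n) (g w) := by
        induction n with
        | zero => simp
        | succ n ih => intro w; rw [pow_succ, pow_succ, Module.End.mul_apply, ih, hg]; rfl
      simp [aeval_monomial, this]
  have hm : aeval (Matrix.toLin' m) m.charpoly = 0 := by
    have := congrArg (Matrix.toLinAlgEquiv' (R := R) (n := Fin p)) m.aeval_self_charpoly
    rw [map_zero, ← aeval_algHom_apply] at this
    exact this
  refine ⟨fun l => m.charpoly.coeff l, fun k => ?_⟩
  have hk := hq m.charpoly (Pi.single k 1)
  have hdeg : m.charpoly.natDegree = p := by simp [Matrix.charpoly_natDegree_eq_dim]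
  have hlead : m.charpoly.coeff p = 1 := by
    have := m.charpoly_monic.coeff_natDegree
    rwa [hdeg] at this
  have hgk : g (Pi.single k 1) = v k := by simp [g]
  rw [hm, LinearMap.zero_apply, map_zero, hgk, aeval_eq_sum_range, hdeg, Finset.sum_range_succ,
    hlead, one_smul, LinearMap.add_apply, Finset.sum_range, LinearMap.sum_apply] at hk
  rw [add_comm]
  exact hk.symm

theorem exists_left_generators {s : Set A} (hfin : s.Finite)
    (hs : ∀ a ∈ s, ∀ b ∈ s, a * b = b * a) {N V : Submodule K A} (hV : V.FG)
    (hN : ∀ q ∈ Algebra.adjoin K s, ∀ y ∈ N, q * y ∈ N)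
    (hle : N ≤ (Algebra.adjoin K s).toSubmodule * V) :
    ∃ (n : ℕ) (g : Fin n → A), (∀ s, g s ∈ N) ∧
      ∀ y ∈ N, ∃ c : Fin n → A, (∀ i, c i ∈ Algebra.adjoin K s) ∧ y = ∑ i, c i * g i := by
  have := hfin.to_subtype
  obtain ⟨φ, hφ⟩ := exists_mvPolynomial_range_eq_adjoin (K := K) s hs
  have hmem (r) : φ r ∈ Algebra.adjoin K s := hφ ▸ ⟨r, rfl⟩
  obtain ⟨n, g, hg, hgen⟩ := exists_fin_generators_of_algHom φ (N := N) hV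
    (fun r y hy => hN _ (hmem r) y hy) <| by
      refine hle.trans (Submodule.mul_le.mpr fun q hq v hv => ?_)
      rw [Subalgebra.mem_toSubmodule, ← hφ] at hq
      obtain ⟨r, rfl⟩ := hq
      exact Submodule.subset_span ⟨r, v, hv, rfl⟩
  refine ⟨n, g, hg, fun y hy => ?_⟩
  obtain ⟨c, hc⟩ := hgen y hy
  exact ⟨fun i => φ (c i), fun i => hmem _, hc⟩

theorem exists_right_generators {s : Set A} (hfin : s.Finite)
    (hs : ∀ a ∈ s, ∀ b ∈ s, a * b = b * a) {N V : Submodule K A} (hV : V.FG)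
    (hN : ∀ q ∈ Algebra.adjoin K s, ∀ y ∈ N, y * q ∈ N)
    (hle : N ≤ V * (Algebra.adjoin K s).toSubmodule) :
    ∃ (n : ℕ) (g : Fin n → A), (∀ s, g s ∈ N) ∧
      ∀ y ∈ N, ∃ c : Fin n → A, (∀ i, c i ∈ Algebra.adjoin K s) ∧ y = ∑ i, g i * c i := by
  have := hfin.to_subtype
  obtain ⟨φ, hφ⟩ := exists_mvPolynomial_range_eq_adjoin (K := K) s hs
  have hmem (r) : φ r ∈ Algebra.adjoin K s := hφ ▸ ⟨r, rfl⟩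
  let φ' : MvPolynomial s K →ₐ[K] Aᵐᵒᵖ :=
    φ.toOpposite fun x y => by rw [commute_iff_eq, ← map_mul, mul_comm, map_mul]
  obtain ⟨n, g, hg, hgen⟩ := exists_fin_generators_of_algHom φ' (N := N) hV
    (fun r y hy => hN _ (hmem r) y hy) <| by
      refine hle.trans (Submodule.mul_le.mpr fun v hv q hq => ?_)
      rw [Subalgebra.mem_toSubmodule, ← hφ] at hq
      obtain ⟨r, rfl⟩ := hq
      exact Submodule.subset_span ⟨r, v, hv, rfl⟩
  refine ⟨n, g, hg, fun y hy => ?_⟩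
  obtain ⟨c, hc⟩ := hgen y hy
  exact ⟨fun i => φ (c i), fun i => hmem _, hc⟩

/-- Every element of the balanced subalgebra generates a bimodule that is finitely generated on
both sides. -/
theorem bimodule_finitely_generated {s : Set A} (hfin : s.Finite)
    (hs : ∀ a ∈ s, ∀ b ∈ s, a * b = b * a) {x : A}
    (hx : x ∈ balancedSubalgebra (Algebra.adjoin K s)) {N : Submodule K A}
    (hN : N = Submodule.span K
      {y | ∃ a ∈ Algebra.adjoin K s, ∃ b ∈ Algebra.adjoin K s, y = a * x * b}) :
    (∃ (n : ℕ) (g : Fin n → A), (∀ s, g s ∈ N) ∧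
      ∀ y ∈ N, ∃ c : Fin n → A, (∀ i, c i ∈ Algebra.adjoin K s) ∧ y = ∑ i, c i * g i) ∧
    (∃ (n : ℕ) (g : Fin n → A), (∀ s, g s ∈ N) ∧
      ∀ y ∈ N, ∃ c : Fin n → A, (∀ i, c i ∈ Algebra.adjoin K s) ∧ y = ∑ i, g i * c i) := by
  obtain ⟨V, hV, hPV, hxV⟩ := hx
  have hle : N ≤ (Algebra.adjoin K s).toSubmodule * V := by
    rw [hN, Submodule.span_le]
    rintro _ ⟨a, ha, b, hb, rfl⟩
    have : a * x * b ∈ (Algebra.adjoin K s).toSubmodule * V * (Algebra.adjoin K s).toSubmodule :=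
      Submodule.mul_mem_mul (Submodule.mul_mem_mul ha hxV) hb
    rwa [mul_assoc _ V, ← hPV, ← mul_assoc _ _ V,
      (Subalgebra.isIdempotentElem_toSubmodule _).eq] at this
  refine ⟨exists_left_generators hfin hs hV (fun q hq y hy => ?_) hle,
    exists_right_generators hfin hs hV (fun q hq y hy => ?_) (hPV ▸ hle)⟩
  · subst hN
    induction hy using Submodule.span_induction with
    | mem y hy =>
      obtain ⟨a, ha, b, hb, rfl⟩ := hy
      exact Submodule.subset_span ⟨q * a, mul_mem hq ha, b, hb, by simp only [mul_assoc]⟩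
    | zero => rw [mul_zero]; exact zero_mem _
    | add y z _ _ hy hz => rw [mul_add]; exact add_mem hy hz
    | smul k y _ hy => rw [mul_smul_comm]; exact Submodule.smul_mem _ _ hy
  · subst hN
    induction hy using Submodule.span_induction with
    | mem y hy =>
      obtain ⟨a, ha, b, hb, rfl⟩ := hy
      exact Submodule.subset_span ⟨a, ha, b * q, mul_mem hb hq, by simp only [mul_assoc]⟩
    | zero => rw [zero_mul]; exact zero_mem _
    | add y z _ _ hy hz => rw [add_mul]; exact add_mem hy hz
    | smul k y _ hy => rw [smul_mul_assoc]; exact Submodule.smul_mem _ _ hy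

theorem exists_sum_mul_of_mem_span_mul {p : ℕ} {v : Fin p → A} {P : Subalgebra K A} {y : A}
    (hy : y ∈ Submodule.span K (Set.range v) * P.toSubmodule) :
    ∃ m : Fin p → A, (∀ l, m l ∈ P) ∧ y = ∑ l, v l * m l := by
  refine Submodule.mul_induction_on hy ?_ ?_
  · intro x hx q hq
    obtain ⟨c, rfl⟩ := (Submodule.mem_span_range_iff_exists_fun K).mp hx
    refine ⟨fun l => c l • q, fun l => P.smul_mem hq _, ?_⟩
    simp [Finset.sum_mul]
  · rintro _ _ ⟨m, hm, rfl⟩ ⟨m', hm', rfl⟩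
    exact ⟨fun l => m l + m' l, fun l => add_mem (hm l) (hm' l), by
      simp [mul_add, Finset.sum_add_distrib]⟩

/-- If left multiplication by `z` preserves the right module generated by `v`, the
Cayley-Hamilton theorem gives a monic relation with coefficients on the right. -/
theorem exists_monic_relation_of_mul_mem {s : Set A}
    (hs : ∀ a ∈ s, ∀ b ∈ s, a * b = b * a) {p : ℕ} (v : Fin p → A) (z : A)
    (hz : ∀ k, z * v k ∈ Submodule.span K (Set.range v) * (Algebra.adjoin K s).toSubmodule) :
    ∃ a : Fin p → A, (∀ l, a l ∈ Algebra.adjoin K s) ∧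
      ∀ k, z ^ p * v k + ∑ l : Fin p, z ^ (l : ℕ) * v k * a l = 0 := by
  obtain ⟨φ, hφ⟩ := exists_mvPolynomial_range_eq_adjoin (K := K) s hs
  have hmem (r) : φ r ∈ Algebra.adjoin K s := hφ ▸ ⟨r, rfl⟩
  let φ' : MvPolynomial s K →ₐ[K] Aᵐᵒᵖ :=
    φ.toOpposite fun x y => by rw [commute_iff_eq, ← map_mul, mul_comm, map_mul]
  let : Module (MvPolynomial s K) A := Module.compHom A φ'.toRingHom
  have hsmul (r : MvPolynomial s K) (y : A) : r • y = y * φ r := rfl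
  let L : A →ₗ[MvPolynomial s K] A :=
    { toFun := fun y => z * y
      map_add' := fun x y => mul_add z x y
      map_smul' := fun r y => (mul_assoc z y (φ r)).symm }
  have hL (n : ℕ) (y : A) : (L ^ n) y = z ^ n * y := by
    induction n with
    | zero => simp
    | succ n ih =>
      rw [pow_succ', Module.End.mul_apply, ih, pow_succ', mul_assoc]
      rfl
  choose m hm hzm using fun k => exists_sum_mul_of_mem_span_mul (hz k)
  have hm' : ∀ l k, ∃ r, φ r = m k l := by
    intro l k
    have := hm k l
    rwa [← hφ] at this
  choose M hM using hm'
  obtain ⟨a, ha⟩ := exists_monic_relation L v M fun k => by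
    simp only [hsmul, hM]
    exact hzm k
  refine ⟨fun l => φ (a l), fun l => hmem _, fun k => ?_⟩
  have := ha k
  simpa only [hsmul, hL] using this

end HarishChandra

section YangianHarishChandra

variable {K A : Type*} [Field K] [Ring A] [Algebra K A] {p : ℕ} {t : Fin 2 → Fin 2 → ℕ → A}

/-- The generators `t_22^(1), …, t_22^(p), d_1, …, d_2p` of the subalgebra `Γ`. -/
def gammaGenerators (p : ℕ) (t : Fin 2 → Fin 2 → ℕ → A) : Set A :=
  {x | ∃ k ∈ Finset.Icc 1 p, x = t 1 1 k} ∪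
    {x | ∃ i ∈ Finset.Icc 1 (2 * p), x = (qdetPoly p t).coeff (2 * p - i)}

theorem gammaGenerators_finite (p : ℕ) (t : Fin 2 → Fin 2 → ℕ → A) :
    (gammaGenerators p t).Finite := by
  refine Set.Finite.union ?_ ?_
  · refine ((Finset.Icc 1 p).finite_toSet.image fun k => t 1 1 k).subset ?_
    rintro _ ⟨k, hk, rfl⟩
    exact ⟨k, hk, rfl⟩
  · refine ((Finset.Icc 1 (2 * p)).finite_toSet.image
      fun i => (qdetPoly p t).coeff (2 * p - i)).subset ?_
    rintro _ ⟨k, hk, rfl⟩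
    exact ⟨k, hk, rfl⟩

theorem IsYangianFamily.mul_qdetPoly_coeff (h : IsYangianFamily p t)
    (htop : ∀ S : Subalgebra K A, (∀ i j k, t i j k ∈ S) → S = ⊤) (n : ℕ) (x : A) :
    x * (qdetPoly p t).coeff n = (qdetPoly p t).coeff n * x := by
  have hx : x ∈ Subalgebra.centralizer K {(qdetPoly p t).coeff n} := by
    rw [htop (Subalgebra.centralizer K {(qdetPoly p t).coeff n})]
    · exact Algebra.mem_top
    · intro i j k
      rw [Subalgebra.mem_centralizer_iff]
      rintro _ rfl
      exact (h.commute_qdetPoly i j k n).symm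
  exact (Subalgebra.mem_centralizer_iff K |>.mp hx _ rfl).symm

theorem IsYangianFamily.gammaGenerators_comm (h : IsYangianFamily p t)
    (htop : ∀ S : Subalgebra K A, (∀ i j k, t i j k ∈ S) → S = ⊤) :
    ∀ a ∈ gammaGenerators p t, ∀ b ∈ gammaGenerators p t, a * b = b * a := by
  rintro _ (⟨k, -, rfl⟩ | ⟨i, -, rfl⟩) _ (⟨l, -, rfl⟩ | ⟨j, -, rfl⟩)
  · exact h.comm 1 1 k l
  · exact h.mul_qdetPoly_coeff htop _ _
  · exact (h.mul_qdetPoly_coeff htop _ _).symm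
  · exact h.mul_qdetPoly_coeff htop _ _

theorem IsYangianFamily.diag_mem_adjoin (h : IsYangianFamily p t) (k : ℕ) :
    t 1 1 k ∈ Algebra.adjoin K (gammaGenerators p t) := by
  rcases Nat.eq_zero_or_pos k with rfl | hk
  · rw [h.zero, if_pos rfl]
    exact one_mem _
  rcases lt_or_ge p k with hp | hp
  · rw [h.of_lt 1 1 hp]
    exact zero_mem _
  exact Algebra.subset_adjoin (Or.inl ⟨k, Finset.mem_Icc.mpr ⟨hk, hp⟩, rfl⟩)

theorem IsYangianFamily.offdiag_mem_span (h : IsYangianFamily p t) {i j : Fin 2} (hij : i ≠ j)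
    (k : ℕ) : t i j k ∈ Submodule.span K (Set.range fun l : Fin p => t i j (l + 1)) := by
  rcases Nat.eq_zero_or_pos k with rfl | hk
  · rw [h.zero, if_neg hij]
    exact zero_mem _
  rcases lt_or_ge p k with hp | hp
  · rw [h.of_lt i j hp]
    exact zero_mem _
  exact Submodule.subset_span ⟨⟨k - 1, by omega⟩, congrArg (t i j) (by simp; omega)⟩

theorem IsYangianFamily.diag_mul_offdiag_mem (h : IsYangianFamily p t) {i j : Fin 2} (hij : i ≠ j)
    (r s : ℕ) :
    t 1 1 r * t i j s ∈ Submodule.span K (Set.range fun l : Fin p => t i j (l + 1)) *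
      (Algebra.adjoin K (gammaGenerators p t)).toSubmodule := by
  have hmem (a b : ℕ) : t i j a * t 1 1 b ∈
      Submodule.span K (Set.range fun l : Fin p => t i j (l + 1)) *
        (Algebra.adjoin K (gammaGenerators p t)).toSubmodule :=
    Submodule.mul_mem_mul (h.offdiag_mem_span hij a) (h.diag_mem_adjoin b)
  have hcases : (i = 1 ∧ j = 0) ∨ (i = 0 ∧ j = 1) := by omega
  rcases hcases with ⟨rfl, rfl⟩ | ⟨rfl, rfl⟩
  · have hr := h.rel 1 0 1 1 s r
    rw [sub_eq_iff_eq_add', ← sub_eq_iff_eq_add] at hr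
    rw [← hr]
    exact sub_mem (hmem _ _) (sum_mem fun a _ => sub_mem (hmem _ _) (hmem _ _))
  · have hr := h.rel 1 1 0 1 r s
    rw [sub_eq_iff_eq_add] at hr
    rw [hr]
    exact add_mem (sum_mem fun a _ => sub_mem (hmem _ _) (hmem _ _)) (hmem _ _)

theorem IsYangianFamily.offdiag_mul_diag_mem (h : IsYangianFamily p t) {i j : Fin 2} (hij : i ≠ j)
    (r s : ℕ) :
    t i j s * t 1 1 r ∈ (Algebra.adjoin K (gammaGenerators p t)).toSubmodule *
      Submodule.span K (Set.range fun l : Fin p => t i j (l + 1)) := by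
  have hmem (a b : ℕ) : t 1 1 b * t i j a ∈
      (Algebra.adjoin K (gammaGenerators p t)).toSubmodule *
        Submodule.span K (Set.range fun l : Fin p => t i j (l + 1)) :=
    Submodule.mul_mem_mul (h.diag_mem_adjoin b) (h.offdiag_mem_span hij a)
  have hcases : (i = 1 ∧ j = 0) ∨ (i = 0 ∧ j = 1) := by omega
  rcases hcases with ⟨rfl, rfl⟩ | ⟨rfl, rfl⟩
  · have hr := h.rel 1 1 1 0 r s
    rw [sub_eq_iff_eq_add', ← sub_eq_iff_eq_add] at hr
    rw [← hr]
    exact sub_mem (hmem _ _) (sum_mem fun a _ => sub_mem (hmem _ _) (hmem _ _))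
  · have hr := h.rel 0 1 1 1 s r
    rw [sub_eq_iff_eq_add] at hr
    rw [hr]
    exact add_mem (sum_mem fun a _ => sub_mem (hmem _ _) (hmem _ _)) (hmem _ _)

theorem IsYangianFamily.adjoin_mul_span_offdiag (h : IsYangianFamily p t)
    (htop : ∀ S : Subalgebra K A, (∀ i j k, t i j k ∈ S) → S = ⊤) {i j : Fin 2} (hij : i ≠ j) :
    (Algebra.adjoin K (gammaGenerators p t)).toSubmodule *
        Submodule.span K (Set.range fun l : Fin p => t i j (l + 1)) =
      Submodule.span K (Set.range fun l : Fin p => t i j (l + 1)) *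
        (Algebra.adjoin K (gammaGenerators p t)).toSubmodule := by
  apply le_antisymm
  · refine adjoin_mul_le_mul_adjoin fun g hg v hv => ?_
    induction hv using Submodule.span_induction with
    | mem x hx =>
      obtain ⟨l, rfl⟩ := hx
      rcases hg with ⟨k, -, rfl⟩ | ⟨n, hn, rfl⟩
      · exact h.diag_mul_offdiag_mem hij _ _
      · rw [← h.mul_qdetPoly_coeff htop]
        exact Submodule.mul_mem_mul (Submodule.subset_span ⟨l, rfl⟩)
          (Algebra.subset_adjoin (Or.inr ⟨n, hn, rfl⟩))
    | zero => rw [mul_zero]; exact zero_mem _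
    | add x y _ _ hx hy => rw [mul_add]; exact add_mem hx hy
    | smul c x _ hx => rw [mul_smul_comm]; exact Submodule.smul_mem _ _ hx
  · refine mul_adjoin_le_adjoin_mul fun g hg v hv => ?_
    induction hv using Submodule.span_induction with
    | mem x hx =>
      obtain ⟨l, rfl⟩ := hx
      rcases hg with ⟨k, -, rfl⟩ | ⟨n, hn, rfl⟩
      · exact h.offdiag_mul_diag_mem hij _ _
      · rw [h.mul_qdetPoly_coeff htop]
        exact Submodule.mul_mem_mul (Algebra.subset_adjoin (Or.inr ⟨n, hn, rfl⟩))
          (Submodule.subset_span ⟨l, rfl⟩)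
    | zero => rw [zero_mul]; exact zero_mem _
    | add x y _ _ hx hy => rw [add_mul]; exact add_mem hx hy
    | smul c x _ hx => rw [smul_mul_assoc]; exact Submodule.smul_mem _ _ hx

theorem coeff_comp_X_sub_one_mem {S : Subring A} {F : A[X]} (hF : ∀ n, F.coeff n ∈ S) (n : ℕ) :
    (F.comp (X - 1)).coeff n ∈ S := by
  have hF' : F ∈ lifts S.subtype := (lifts_iff_coeff_lifts F).mpr fun n => ⟨⟨_, hF n⟩, rfl⟩
  obtain ⟨G, rfl⟩ := (mem_lifts F).mp hF'
  have : (G.map S.subtype).comp (X - 1) = (G.comp (X - 1)).map S.subtype := by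
    rw [map_comp]
    simp
  rw [this, coeff_map]
  exact ((G.comp (X - 1)).coeff n).2

theorem coeff_mul_mem {S : Subring A} {F G : A[X]} (hF : ∀ n, F.coeff n ∈ S)
    (hG : ∀ n, G.coeff n ∈ S) (n : ℕ) : (F * G).coeff n ∈ S := by
  rw [coeff_mul]
  exact sum_mem fun x _ => mul_mem (hF _) (hG _)

theorem IsYangianFamily.coeff_genPoly (h : IsYangianFamily p t) (i j : Fin 2) {n : ℕ}
    (hn : n ≤ p) : (genPoly p t i j).coeff n = t i j (p - n) := by
  rw [h.genPoly_eq_sum, finsetSum_coeff, Finset.sum_eq_single (p - n)]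
  · rw [coeff_C_mul_X_pow, if_pos (by omega)]
  · intro r hr hrn
    rw [Finset.mem_range] at hr
    rw [coeff_C_mul_X_pow, if_neg (by omega)]
  · intro hn'
    exact absurd (Finset.mem_range.mpr (by omega)) hn'

theorem IsYangianFamily.natDegree_genPoly_le (h : IsYangianFamily p t) (i j : Fin 2) :
    (genPoly p t i j).natDegree ≤ p := by
  rw [h.genPoly_eq_sum]
  exact natDegree_sum_le_of_forall_le _ _ fun r _ =>
    (natDegree_C_mul_X_pow_le _ _).trans (Nat.sub_le p r)

theorem IsYangianFamily.coeff_genPoly_mem (h : IsYangianFamily p t) {S : Subring A} {i j : Fin 2}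
    (hS : ∀ k, t i j k ∈ S) (n : ℕ) : (genPoly p t i j).coeff n ∈ S := by
  rcases le_or_gt n p with hn | hn
  · rw [h.coeff_genPoly i j hn]
    exact hS _
  · rw [coeff_eq_zero_of_natDegree_lt ((h.natDegree_genPoly_le i j).trans_lt hn)]
    exact zero_mem _

/-- If `F Q` has coefficients in `S` in degrees `p, …, p + N - 1`, where `Q` is monic of degree
`p` over `S`, and those of `F` in degrees at least `N` are in `S`, then `F` is over `S`. -/
theorem coeff_mem_of_mul_monic {S : Subring A} {F Q : A[X]} {p N : ℕ} (hQ : ∀ n, Q.coeff n ∈ S)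
    (hQdeg : Q.natDegree ≤ p) (hQp : Q.coeff p = 1) (hF : ∀ n, N ≤ n → F.coeff n ∈ S)
    (hFQ : ∀ n, n < N → (F * Q).coeff (n + p) ∈ S) (n : ℕ) : F.coeff n ∈ S := by
  induction hm : N - n using Nat.strong_induction_on generalizing n with
  | _ m ih =>
    rcases le_or_gt N n with hn | hn
    · exact hF n hn
    have hc := hFQ n hn
    rw [coeff_mul, ← Finset.add_sum_erase _ _
      (Finset.HasAntidiagonal.mem_antidiagonal.mpr rfl :
        (n, p) ∈ Finset.HasAntidiagonal.antidiagonal (n + p))] at hc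
    rw [hQp, mul_one] at hc
    refine (add_mem_cancel_right ?_).mp hc
    refine sum_mem fun x hx => ?_
    rw [Finset.mem_erase, Finset.HasAntidiagonal.mem_antidiagonal] at hx
    rcases lt_trichotomy x.2 p with hlt | heq | hgt
    · exact mul_mem (ih (N - x.1) (by omega) x.1 rfl) (hQ _)
    · exact absurd (Prod.ext (by omega) heq) hx.1
    · rw [coeff_eq_zero_of_natDegree_lt (hQdeg.trans_lt hgt), mul_zero]
      exact zero_mem _

theorem IsYangianFamily.mem_of_mem (h : IsYangianFamily p t) {S : Subring A}
    (h11 : ∀ k, t 1 1 k ∈ S) (h10 : ∀ k, t 1 0 k ∈ S) (h01 : ∀ k, t 0 1 k ∈ S)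
    (hd : ∀ n, n < 2 * p → (qdetPoly p t).coeff n ∈ S) (k : ℕ) : t 0 0 k ∈ S := by
  rcases lt_or_ge p k with hp | hp
  · rw [h.of_lt 0 0 hp]
    exact zero_mem _
  nontriviality A
  have hQ : ((genPoly p t 1 1).comp (X - 1)).natDegree ≤ p := by
    refine natDegree_comp_le.trans ?_
    rw [← C_1, natDegree_X_sub_C, mul_one]
    exact h.natDegree_genPoly_le 1 1
  have hQp : ((genPoly p t 1 1).comp (X - 1)).coeff p = 1 := by
    have h1 : (genPoly p t 1 1).coeff p = 1 := by
      rw [h.coeff_genPoly 1 1 le_rfl, Nat.sub_self, h.zero, if_pos rfl]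
    have hdeg : (genPoly p t 1 1).natDegree = p :=
      natDegree_eq_of_le_of_coeff_ne_zero (h.natDegree_genPoly_le 1 1) (h1 ▸ one_ne_zero)
    have hX : ((X : A[X]) - 1).natDegree = 1 := by rw [← C_1, natDegree_X_sub_C]
    have hlead : ((X : A[X]) - 1).leadingCoeff = 1 := by rw [← C_1, leadingCoeff_X_sub_C]
    have hcomp := coeff_comp_degree_mul_degree (p := genPoly p t 1 1) (hX ▸ one_ne_zero)
    rwa [hX, hlead, one_pow, mul_one, mul_one, leadingCoeff, hdeg, h1] at hcomp
  have hF := coeff_mem_of_mul_monic (S := S) (F := genPoly p t 0 0) (N := p)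
    (coeff_comp_X_sub_one_mem (h.coeff_genPoly_mem h11)) hQ hQp
    (fun n hn => by
      rcases hn.eq_or_lt with rfl | hn
      · rw [h.coeff_genPoly 0 0 le_rfl, Nat.sub_self, h.zero, if_pos rfl]
        exact one_mem _
      · rw [coeff_eq_zero_of_natDegree_lt ((h.natDegree_genPoly_le 0 0).trans_lt hn)]
        exact zero_mem _)
    (fun n hn => by
      have := add_mem (hd (n + p) (by omega)) (coeff_mul_mem (h.coeff_genPoly_mem h10)
        (coeff_comp_X_sub_one_mem (h.coeff_genPoly_mem h01)) (n + p))
      rwa [← coeff_add, qdetPoly, sub_add_cancel] at this)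
    (p - k)
  rwa [h.coeff_genPoly 0 0 (Nat.sub_le p k), Nat.sub_sub_self hp] at hF

theorem IsYangianFamily.balancedSubalgebra_eq_top (h : IsYangianFamily p t)
    (htop : ∀ S : Subalgebra K A, (∀ i j k, t i j k ∈ S) → S = ⊤) :
    balancedSubalgebra (Algebra.adjoin K (gammaGenerators p t)) = ⊤ := by
  have hcomm := Algebra.isMulCommutative_adjoin K (h.gammaGenerators_comm htop)
  have hmem {x : A} (hx : x ∈ Algebra.adjoin K (gammaGenerators p t)) :
      x ∈ balancedSubalgebra (Algebra.adjoin K (gammaGenerators p t)) :=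
    mem_balancedSubalgebra_of_commute fun y hy =>
      congrArg Subtype.val (hcomm.is_comm.comm ⟨x, hx⟩ ⟨y, hy⟩)
  have hoff {i j : Fin 2} (hij : i ≠ j) (k : ℕ) :
      t i j k ∈ balancedSubalgebra (Algebra.adjoin K (gammaGenerators p t)) :=
    ⟨_, Submodule.fg_span (Set.finite_range _), h.adjoin_mul_span_offdiag htop hij,
      h.offdiag_mem_span hij k⟩
  have h11 (k) := hmem (h.diag_mem_adjoin (K := K) k)
  refine htop _ fun i j k => ?_
  fin_cases i <;> fin_cases j
  · refine h.mem_of_mem (S := (balancedSubalgebra _).toSubring) h11 (hoff (by decide))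
      (hoff (by decide)) (fun n hn => hmem (Algebra.subset_adjoin ?_)) k
    exact Or.inr ⟨2 * p - n, Finset.mem_Icc.mpr ⟨by omega, by omega⟩, by
      rw [Nat.sub_sub_self hn.le]⟩
  · exact hoff (by decide) k
  · exact hoff (by decide) k
  · exact h11 k

end YangianHarishChandra

theorem eq_top_of_tY_mem (K : Type) [Field K] (p : ℕ) (S : Subalgebra K (Yp K p))
    (hS : ∀ i j k, tY K p i j k ∈ S) : S = ⊤ := by
  refine eq_top_iff.mpr fun x _ => ?_
  obtain ⟨y, rfl⟩ := RingQuot.mkAlgHom_surjective K (YRel K p) x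
  induction y using FreeAlgebra.induction with
  | grade0 r => rw [AlgHom.commutes]; exact S.algebraMap_mem r
  | grade1 g =>
    obtain ⟨i, j, k⟩ := g
    have := hS i j (k + 1)
    rw [tY, tF, dif_neg (by omega), dif_pos (by omega)] at this
    exact this
  | mul a b ha hb => rw [map_mul]; exact S.mul_mem (ha trivial) (hb trivial)
  | add a b ha hb => rw [map_add]; exact S.add_mem (ha trivial) (hb trivial)

/-- `Γ` is a Harish-Chandra subalgebra of `Y_p(gl_2)`: for every `x` the bimodule
`Γ x Γ` is finitely generated as a left `Γ`-module and as a right `Γ`-module.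
In particular, for `x = t_21^(k)` and `z = t_22^(i)` there is a monic relation
`(t_22^(i))^p t_21^(k) + Σ_(l<p) (t_22^(i))^l t_21^(k) a_l = 0` with `a_l ∈ Γ`. -/
theorem Gam_is_Harish_Chandra_subalgebra (K : Type) [Field K] (p : ℕ) :
    (∀ x : Yp K p,
      (∃ (n : ℕ) (g : Fin n → Yp K p), (∀ s, g s ∈ GamxGam K p x) ∧
        ∀ y ∈ GamxGam K p x, ∃ c : Fin n → Yp K p, (∀ s, c s ∈ Gam K p) ∧
          y = ∑ s, c s * g s) ∧
      (∃ (n : ℕ) (g : Fin n → Yp K p), (∀ s, g s ∈ GamxGam K p x) ∧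
        ∀ y ∈ GamxGam K p x, ∃ c : Fin n → Yp K p, (∀ s, c s ∈ Gam K p) ∧
          y = ∑ s, g s * c s)) ∧
    (∀ i k : ℕ, 1 ≤ i → i ≤ p → 1 ≤ k → k ≤ p →
      ∃ a : Fin p → Yp K p, (∀ l, a l ∈ Gam K p) ∧
        tY K p 1 1 i ^ p * tY K p 1 0 k +
          ∑ l : Fin p, tY K p 1 1 i ^ (l : ℕ) * tY K p 1 0 k * a l = 0) := by
  have h := tY_isYangianFamily K p
  have htop := eq_top_of_tY_mem K p
  have hcomm := h.gammaGenerators_comm (K := K) htop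
  refine ⟨fun x => bimodule_finitely_generated (K := K) (gammaGenerators_finite p (tY K p)) hcomm
    (h.balancedSubalgebra_eq_top htop ▸ Algebra.mem_top) rfl, fun i k hi hi' hk hk' => ?_⟩
  obtain ⟨a, ha, hrel⟩ := exists_monic_relation_of_mul_mem (K := K) hcomm
    (fun l : Fin p => tY K p 1 0 (l + 1)) (tY K p 1 1 i)
    fun l => h.diag_mul_offdiag_mem (by decide) i (l + 1)
  refine ⟨a, ha, ?_⟩
  have := hrel ⟨k - 1, by omega⟩
  simpa only [Nat.sub_add_cancel hk] using this
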